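/- The substitution rule (sub): from Γ ⇒^T Δ infer Γσ ⇒^{Tσ} Δσ, where σ is a uniform substitution (mapping propositional variables to formulas and agent nominals to agent nominals), Tσ is the tree obtained by applying σ to the nominal labels of edges of T, and Γσ, Δσ apply σ to all formulas and relabel labels accordingly, is height-preserving admissible in both TEFL⁻ and TEFL. -/

import Mathlib

set_option autoImplicit false

/-- Formulas of Epistemic Logic of Friendship:
    nominals, propositional variables, ⊥, →, @ₙ, F, □. -/
inductive Form : Type
  | nom : ℕ → Form
  | pv  : ℕ → Form
  | bot : Form
  | imp : Form → Form → Form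
  | atf : ℕ → Form → Form
  | fr  : Form → Form
  | box : Form → Form
  deriving DecidableEq

def Form.neg (φ : Form) : Form := Form.imp φ Form.bot
def Form.top : Form := Form.neg Form.bot
def Form.and (φ ψ : Form) : Form := Form.neg (Form.imp φ (Form.neg ψ))
def Form.or (φ ψ : Form) : Form := Form.imp (Form.neg φ) ψ
def Form.iff (φ ψ : Form) : Form := Form.and (Form.imp φ ψ) (Form.imp ψ φ)
/-- ⟨F⟩φ := ¬F¬φ -/
def Form.diaF (φ : Form) : Form := Form.neg (Form.fr (Form.neg φ))

/-- `Form.sub m k φ` is φ[m/k] : substitute nominal k by nominal m. -/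
def Form.sub (m k : ℕ) : Form → Form
  | .nom n => if n = k then .nom m else .nom n
  | .pv p => .pv p
  | .bot => .bot
  | .imp φ ψ => .imp (Form.sub m k φ) (Form.sub m k ψ)
  | .atf n φ => .atf (if n = k then m else n) (Form.sub m k φ)
  | .fr φ => .fr (Form.sub m k φ)
  | .box φ => .box (Form.sub m k φ)

/-- nominals occurring in a formula -/
def Form.noms : Form → Finset ℕ
  | .nom n => {n}
  | .pv _ => ∅
  | .bot => ∅
  | .imp φ ψ => Form.noms φ ∪ Form.noms ψ
  | .atf n φ => insert n (Form.noms φ)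
  | .fr φ => Form.noms φ
  | .box φ => Form.noms φ

/-- Labels: natural numbers are labels, and `child α n i` is the label α·ₙi,
    an n-child of α. -/
inductive Label : Type
  | root : ℕ → Label
  | child : Label → ℕ → ℕ → Label
  deriving DecidableEq

/-- nominals occurring in a label -/
def Label.noms : Label → Finset ℕ
  | .root _ => ∅
  | .child α n _ => insert n (Label.noms α)

/-- natural numbers occurring in a label -/
def Label.nats : Label → Finset ℕ
  | .root j => {j}
  | .child α _ i => insert i (Label.nats α)

/-- apply a nominal renaming to (the edge nominals of) a label -/
def Label.subst (σn : ℕ → ℕ) : Label → Label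
  | .root j => .root j
  | .child α n i => .child (Label.subst σn α) (σn n) i

/-- A labelled formula (α, φ) stands for α:φ, where φ is intended @-prefixed. -/
abbrev LForm : Type := Label × Form

/-- A finite tree of labels: a unique natural-number root, closed under parents. -/
def IsTree (T : Finset Label) : Prop :=
  (∃! j : ℕ, Label.root j ∈ T) ∧ ∀ α n i, Label.child α n i ∈ T → α ∈ T

/-- A (possibly infinite) tree of labels. -/
def SetIsTree (T : Set Label) : Prop :=
  (∃! j : ℕ, Label.root j ∈ T) ∧ ∀ α n i, Label.child α n i ∈ T → α ∈ T

/-- A frame: states, agents, accessibility Rₐ and friendship ≍_w. -/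
structure Frame (W A : Type) : Type where
  wne : Nonempty W
  ane : Nonempty A
  R : A → W → W → Prop
  friend : W → A → A → Prop

/-- A model: a frame with a valuation; nominals denote unique agents via `Vn`
    (this builds in V(n) = W × {n̲}). -/
structure Model (W A : Type) extends Frame W A where
  Vp : ℕ → W → A → Prop
  Vn : ℕ → A

section Semantics
variable {W A : Type}

/-- Two-dimensional satisfaction M,(w,a) ⊨ φ. -/
def Sat (M : Model W A) : W → A → Form → Prop
  | _, a, .nom n => M.Vn n = a
  | w, a, .pv p => M.Vp p w a
  | _, _, .bot => False
  | w, a, .imp φ ψ => Sat M w a φ → Sat M w a ψ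
  | w, _, .atf n φ => Sat M w (M.Vn n) φ
  | w, a, .fr φ => ∀ b, M.friend w a b → Sat M w b φ
  | w, a, .box φ => ∀ v, M.R a w v → Sat M v a φ

/-- f is a T-assignment: it respects the n-child edges of T. -/
def IsAssign (M : Model W A) (T : Finset Label) (f : Label → W) : Prop :=
  ∀ α n i, Label.child α n i ∈ T → M.R (M.Vn n) (f α) (f (Label.child α n i))

/-- Truth of a labelled formula α:@ₙφ at (M,f); for @-prefixed formulas
    the agent coordinate is irrelevant. -/
def LSat (M : Model W A) (f : Label → W) (l : LForm) : Prop :=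
  ∀ a : A, Sat M (f l.1) a l.2

/-- Truth of a tree sequent Γ ⇒ᵀ Δ at (M,f). -/
def SeqTrue (M : Model W A) (f : Label → W) (Γ Δ : Finset LForm) : Prop :=
  (∀ l ∈ Γ, LSat M f l) → ∃ l ∈ Δ, LSat M f l

end Semantics

/-- Nominal m is fresh in the sequent Γ ⇒ᵀ Δ. -/
def FreshNom (m : ℕ) (T : Finset Label) (Γ Δ : Finset LForm) : Prop :=
  (∀ β ∈ T, m ∉ Label.noms β) ∧
    (∀ l ∈ Γ, m ∉ Label.noms l.1 ∧ m ∉ Form.noms l.2) ∧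
    (∀ l ∈ Δ, m ∉ Label.noms l.1 ∧ m ∉ Form.noms l.2)

/-- Natural number i is fresh in the sequent Γ ⇒ᵀ Δ. -/
def FreshNat (i : ℕ) (T : Finset Label) (Γ Δ : Finset LForm) : Prop :=
  (∀ β ∈ T, i ∉ Label.nats β) ∧
    (∀ l ∈ Γ, i ∉ Label.nats l.1) ∧ (∀ l ∈ Δ, i ∉ Label.nats l.1)

/-- Tree-sequent derivations of height ≤ h.  `Deriv true` is TEFL (with Cut),
    `Deriv false` is TEFL⁻ (without Cut). -/
inductive Deriv (c : Bool) : Finset Label → Finset LForm → Finset LForm → ℕ → Prop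
  | bot {T : Finset Label} {Γ Δ : Finset LForm} (α : Label) (n : ℕ) :
      Deriv c T (insert (α, Form.atf n Form.bot) Γ) Δ 0
  | id {T : Finset Label} {Γ Δ : Finset LForm} (α : Label) (n : ℕ) (φ : Form) :
      Deriv c T (insert (α, Form.atf n φ) Γ) (insert (α, Form.atf n φ) Δ) 0
  | rep1 {T : Finset Label} {Γ Δ : Finset LForm} {h : ℕ} (α : Label) (n m k : ℕ) (φ : Form) :
      Deriv c T (insert (α, Form.atf n (Form.nom m)) (insert (α, Form.sub n k φ) Γ)) Δ h →
      Deriv c T (insert (α, Form.atf n (Form.nom m)) (insert (α, Form.sub m k φ) Γ)) Δ (h+1)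
  | rep2 {T : Finset Label} {Γ Δ : Finset LForm} {h : ℕ} (α : Label) (n m k : ℕ) (φ : Form) :
      Deriv c T (insert (α, Form.atf n (Form.nom m)) (insert (α, Form.sub m k φ) Γ)) Δ h →
      Deriv c T (insert (α, Form.atf n (Form.nom m)) (insert (α, Form.sub n k φ) Γ)) Δ (h+1)
  | refl {T : Finset Label} {Γ Δ : Finset LForm} {h : ℕ} (α : Label) (n : ℕ) :
      α ∈ T →
      Deriv c T (insert (α, Form.atf n (Form.nom n)) Γ) Δ h →
      Deriv c T Γ Δ (h+1)
  | rigid {T : Finset Label} {Γ Δ : Finset LForm} {h : ℕ} (α β : Label) (n m : ℕ) :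
      β ∈ T →
      Deriv c T (insert (β, Form.atf n (Form.nom m)) Γ) Δ h →
      Deriv c T (insert (α, Form.atf n (Form.nom m)) Γ) Δ (h+1)
  | impR {T : Finset Label} {Γ Δ : Finset LForm} {h : ℕ} (α : Label) (n : ℕ) (φ ψ : Form) :
      Deriv c T (insert (α, Form.atf n φ) Γ) (insert (α, Form.atf n ψ) Δ) h →
      Deriv c T Γ (insert (α, Form.atf n (Form.imp φ ψ)) Δ) (h+1)
  | impL {T : Finset Label} {Γ Δ : Finset LForm} {h₁ h₂ : ℕ} (α : Label) (n : ℕ) (φ ψ : Form) :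
      Deriv c T Γ (insert (α, Form.atf n φ) Δ) h₁ →
      Deriv c T (insert (α, Form.atf n ψ) Γ) Δ h₂ →
      Deriv c T (insert (α, Form.atf n (Form.imp φ ψ)) Γ) Δ (max h₁ h₂ + 1)
  | atR {T : Finset Label} {Γ Δ : Finset LForm} {h : ℕ} (α : Label) (n m : ℕ) (φ : Form) :
      Deriv c T Γ (insert (α, Form.atf m φ) Δ) h →
      Deriv c T Γ (insert (α, Form.atf n (Form.atf m φ)) Δ) (h+1)
  | atL {T : Finset Label} {Γ Δ : Finset LForm} {h : ℕ} (α : Label) (n m : ℕ) (φ : Form) :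
      Deriv c T (insert (α, Form.atf m φ) Γ) Δ h →
      Deriv c T (insert (α, Form.atf n (Form.atf m φ)) Γ) Δ (h+1)
  | frR {T : Finset Label} {Γ Δ : Finset LForm} {h : ℕ} (α : Label) (n m : ℕ) (φ : Form) :
      FreshNom m T Γ (insert (α, Form.atf n (Form.fr φ)) Δ) →
      Deriv c T (insert (α, Form.atf n (Form.diaF (Form.nom m))) Γ)
        (insert (α, Form.atf m φ) Δ) h →
      Deriv c T Γ (insert (α, Form.atf n (Form.fr φ)) Δ) (h+1)
  | frL {T : Finset Label} {Γ Δ : Finset LForm} {h₁ h₂ : ℕ} (α : Label) (n m : ℕ) (φ : Form) :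
      Deriv c T Γ (insert (α, Form.atf n (Form.diaF (Form.nom m))) Δ) h₁ →
      Deriv c T (insert (α, Form.atf m φ) Γ) Δ h₂ →
      Deriv c T (insert (α, Form.atf n (Form.fr φ)) Γ) Δ (max h₁ h₂ + 1)
  | boxR {T : Finset Label} {Γ Δ : Finset LForm} {h : ℕ} (α : Label) (n i : ℕ) (φ : Form) :
      FreshNat i T Γ (insert (α, Form.atf n (Form.box φ)) Δ) →
      Deriv c (insert (Label.child α n i) T) Γ
        (insert (Label.child α n i, Form.atf n φ) Δ) h →
      Deriv c T Γ (insert (α, Form.atf n (Form.box φ)) Δ) (h+1)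
  | boxL {T : Finset Label} {Γ Δ : Finset LForm} {h : ℕ} (α : Label) (n i : ℕ) (φ : Form) :
      Label.child α n i ∈ T →
      Deriv c T (insert (Label.child α n i, Form.atf n φ) Γ) Δ h →
      Deriv c T (insert (α, Form.atf n (Form.box φ)) Γ) Δ (h+1)
  | wlab {T : Finset Label} {Γ Δ : Finset LForm} {h : ℕ} (α : Label) :
      IsTree (insert α T) →
      Deriv c T Γ Δ h →
      Deriv c (insert α T) Γ Δ (h+1)
  | cut {T : Finset Label} {Γ Δ P S : Finset LForm} {h₁ h₂ : ℕ} (α : Label) (n : ℕ) (φ : Form) :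
      c = true → α ∈ T →
      Deriv c T Γ (insert (α, Form.atf n φ) Δ) h₁ →
      Deriv c T (insert (α, Form.atf n φ) P) S h₂ →
      Deriv c T (Γ ∪ P) (Δ ∪ S) (max h₁ h₂ + 1)

/-- Provability of a finite tree sequent (`true` = TEFL, `false` = TEFL⁻). -/
def Provable (c : Bool) (T : Finset Label) (Γ Δ : Finset LForm) : Prop :=
  ∃ h : ℕ, Deriv c T Γ Δ h

/-- Provability of a possibly infinite tree sequent in TEFL⁻ :
    some finite subsequent over a finite subtree is provable. -/
def InfProvable (T : Set Label) (Γ Δ : Set LForm) : Prop :=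
  ∃ (T' : Finset Label) (Γ' Δ' : Finset LForm),
    ↑T' ⊆ T ∧ IsTree T' ∧ ↑Γ' ⊆ Γ ∧ ↑Δ' ⊆ Δ ∧ Provable false T' Γ' Δ'

/-- Saturation conditions for a possibly infinite tree sequent. -/
structure Saturated (T : Set Label) (Γ Δ : Set LForm) : Prop where
  rep1 : ∀ (α : Label) (n m k : ℕ) (φ : Form),
    (α, Form.atf n (Form.nom m)) ∈ Γ → (α, Form.sub n k φ) ∈ Γ → (α, Form.sub m k φ) ∈ Γ
  rep2 : ∀ (α : Label) (n m k : ℕ) (φ : Form),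
    (α, Form.atf m (Form.nom n)) ∈ Γ → (α, Form.sub n k φ) ∈ Γ → (α, Form.sub m k φ) ∈ Γ
  refl : ∀ α ∈ T, ∀ n : ℕ, (α, Form.atf n (Form.nom n)) ∈ Γ
  rigid : ∀ (α β : Label) (n m : ℕ), β ∈ T →
    (α, Form.atf n (Form.nom m)) ∈ Γ → (β, Form.atf n (Form.nom m)) ∈ Γ
  impR : ∀ (α : Label) (n : ℕ) (φ ψ : Form), (α, Form.atf n (Form.imp φ ψ)) ∈ Δ →
    (α, Form.atf n φ) ∈ Γ ∧ (α, Form.atf n ψ) ∈ Δ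
  impL : ∀ (α : Label) (n : ℕ) (φ ψ : Form), (α, Form.atf n (Form.imp φ ψ)) ∈ Γ →
    (α, Form.atf n φ) ∈ Δ ∨ (α, Form.atf n ψ) ∈ Γ
  atR : ∀ (α : Label) (n m : ℕ) (φ : Form), (α, Form.atf n (Form.atf m φ)) ∈ Δ →
    (α, Form.atf m φ) ∈ Δ
  atL : ∀ (α : Label) (n m : ℕ) (φ : Form), (α, Form.atf n (Form.atf m φ)) ∈ Γ →
    (α, Form.atf m φ) ∈ Γ
  frR : ∀ (α : Label) (n : ℕ) (φ : Form), (α, Form.atf n (Form.fr φ)) ∈ Δ →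
    ∃ m : ℕ, (α, Form.atf n (Form.diaF (Form.nom m))) ∈ Γ ∧ (α, Form.atf m φ) ∈ Δ
  frL : ∀ (α : Label) (n : ℕ) (φ : Form), (α, Form.atf n (Form.fr φ)) ∈ Γ →
    ∀ m : ℕ, (α, Form.atf n (Form.diaF (Form.nom m))) ∈ Δ ∨ (α, Form.atf m φ) ∈ Γ
  boxR : ∀ (α : Label) (n : ℕ) (φ : Form), (α, Form.atf n (Form.box φ)) ∈ Δ →
    ∃ i : ℕ, Label.child α n i ∈ T ∧ (Label.child α n i, Form.atf n φ) ∈ Δ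
  boxL : ∀ (α : Label) (n : ℕ) (φ : Form), (α, Form.atf n (Form.box φ)) ∈ Γ →
    ∀ i : ℕ, Label.child α n i ∈ T → (Label.child α n i, Form.atf n φ) ∈ Γ

/-- n ~ m iff α:@ₙm ∈ Γ for some α ∈ T. -/
def nrel (T : Set Label) (Γ : Set LForm) (n m : ℕ) : Prop :=
  ∃ α ∈ T, (α, Form.atf n (Form.nom m)) ∈ Γ

/-- Propositional tautology (instance): true under every boolean valuation
    respecting ⊥ and →. -/
def IsTaut (φ : Form) : Prop :=
  ∀ v : Form → Bool, v Form.bot = false →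
    (∀ ψ χ : Form, v (Form.imp ψ χ) = (!(v ψ) || v χ)) → v φ = true

/-- Uniform substitution: propositional variables by formulas, nominals by nominals. -/
def ApplySub (σp : ℕ → Form) (σn : ℕ → ℕ) : Form → Form
  | .nom n => .nom (σn n)
  | .pv p => σp p
  | .bot => .bot
  | .imp φ ψ => .imp (ApplySub σp σn φ) (ApplySub σp σn ψ)
  | .atf n φ => .atf (σn n) (ApplySub σp σn φ)
  | .fr φ => .fr (ApplySub σp σn φ)
  | .box φ => .box (ApplySub σp σn φ)

/-- Necessity forms L ::= # | ψ→L | @ₙ□L. -/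
inductive NForm : Type
  | hole : NForm
  | imp : Form → NForm → NForm
  | atBox : ℕ → NForm → NForm

/-- L(χ): replace the unique occurrence of # in L by χ. -/
def NForm.fill : NForm → Form → Form
  | .hole, χ => χ
  | .imp ψ L, χ => Form.imp ψ (NForm.fill L χ)
  | .atBox n L, χ => Form.atf n (Form.box (NForm.fill L χ))

/-- The Hilbert system HEFL, extended by an extra set `ax` of axioms
    (HEFL itself is `Hil ∅`). -/
inductive Hil (ax : Set Form) : Form → Prop
  | extra {φ : Form} : φ ∈ ax → Hil ax φ
  | taut {φ : Form} : IsTaut φ → Hil ax φ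
  | kBox (p q : ℕ) : Hil ax (Form.imp (Form.box (Form.imp (Form.pv p) (Form.pv q)))
      (Form.imp (Form.box (Form.pv p)) (Form.box (Form.pv q))))
  | kF (p q : ℕ) : Hil ax (Form.imp (Form.fr (Form.imp (Form.pv p) (Form.pv q)))
      (Form.imp (Form.fr (Form.pv p)) (Form.fr (Form.pv q))))
  | kAt (n p q : ℕ) : Hil ax (Form.imp (Form.atf n (Form.imp (Form.pv p) (Form.pv q)))
      (Form.imp (Form.atf n (Form.pv p)) (Form.atf n (Form.pv q))))
  | refAx (n : ℕ) : Hil ax (Form.atf n (Form.nom n))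
  | selfdual (n p : ℕ) : Hil ax (Form.iff (Form.neg (Form.atf n (Form.pv p)))
      (Form.atf n (Form.neg (Form.pv p))))
  | elim (n p : ℕ) : Hil ax (Form.imp (Form.atf n (Form.pv p))
      (Form.imp (Form.nom n) (Form.pv p)))
  | agree (n m p : ℕ) : Hil ax (Form.imp (Form.atf n (Form.atf m (Form.pv p)))
      (Form.atf m (Form.pv p)))
  | back (n p : ℕ) : Hil ax (Form.imp (Form.atf n (Form.pv p))
      (Form.fr (Form.atf n (Form.pv p))))
  | dcom (n p : ℕ) : Hil ax (Form.iff (Form.atf n (Form.box (Form.atf n (Form.pv p))))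
      (Form.atf n (Form.box (Form.pv p))))
  | rigidEq (n m : ℕ) : Hil ax (Form.imp (Form.atf n (Form.nom m))
      (Form.box (Form.atf n (Form.nom m))))
  | rigidNeq (n m : ℕ) : Hil ax (Form.imp (Form.neg (Form.atf n (Form.nom m)))
      (Form.box (Form.neg (Form.atf n (Form.nom m)))))
  | mp {φ ψ : Form} : Hil ax (Form.imp φ ψ) → Hil ax φ → Hil ax ψ
  | necBox {φ : Form} : Hil ax φ → Hil ax (Form.box φ)
  | necF {φ : Form} : Hil ax φ → Hil ax (Form.fr φ)
  | necAt {φ : Form} (n : ℕ) : Hil ax φ → Hil ax (Form.atf n φ)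
  | us {φ : Form} (σp : ℕ → Form) (σn : ℕ → ℕ) : Hil ax φ → Hil ax (ApplySub σp σn φ)
  | name {φ : Form} (n : ℕ) : n ∉ Form.noms φ →
      Hil ax (Form.imp (Form.nom n) φ) → Hil ax φ
  | lbg {φ : Form} (L : NForm) (n m : ℕ) :
      m ∉ Form.noms (NForm.fill L (Form.atf n (Form.fr φ))) →
      Hil ax (NForm.fill L (Form.imp (Form.atf n (Form.diaF (Form.nom m))) (Form.atf m φ))) →
      Hil ax (NForm.fill L (Form.atf n (Form.fr φ)))

/-- finite conjunction (empty = ⊤) -/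
def conjList : List Form → Form
  | [] => Form.top
  | φ :: l => Form.and φ (conjList l)

/-- finite disjunction (empty = ⊥) -/
def disjList : List Form → Form
  | [] => Form.bot
  | φ :: l => Form.or φ (disjList l)

/-- Formulaic translation, with a fuel parameter bounding the recursion depth. -/
noncomputable def translAux : ℕ → Finset Label → Finset LForm → Finset LForm → Label → Form
  | 0, _, _, _, _ => Form.bot
  | d+1, T, Γ, Δ, α =>
    Form.imp (conjList ((Γ.filter (fun l => l.1 = α)).toList.map Prod.snd))
      (disjList (((Δ.filter (fun l => l.1 = α)).toList.map Prod.snd) ++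
        (T.toList.filterMap (fun β =>
          match β with
          | Label.child γ n i =>
            if γ = α then
              some (Form.atf n (Form.box (translAux d T Γ Δ (Label.child γ n i))))
            else none
          | Label.root _ => none))))

/-- ⟦Γ ⇒ᵀ Δ⟧_α : the formulaic translation of a tree sequent at label α. -/
noncomputable def transl (T : Finset Label) (Γ Δ : Finset LForm) (α : Label) : Form :=
  translAux (T.card + 1) T Γ Δ α

section FrameValidity
variable {W A : Type}

/-- A formula is valid in a frame: true under every valuation at every pair. -/
def FrameValid (F : Frame W A) (φ : Form) : Prop :=
  ∀ (Vp : ℕ → W → A → Prop) (Vn : ℕ → A) (w : W) (a : A),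
    Sat { toFrame := F, Vp := Vp, Vn := Vn } w a φ

end FrameValidity

/-- Formulas of the shape @ₙm or @ₙ⟨F⟩m. -/
def IsRho (φ : Form) : Prop :=
  (∃ n m : ℕ, φ = Form.atf n (Form.nom m)) ∨
    (∃ n m : ℕ, φ = Form.atf n (Form.diaF (Form.nom m)))

/-- Regular implications (ρ₁ ∧ … ∧ ρ_h) → (ρ₁' ∨ … ∨ ρ_l'). -/
def IsRegImp (φ : Form) : Prop :=
  ∃ l₁ l₂ : List Form, (∀ ρ ∈ l₁, IsRho ρ) ∧ (∀ ρ ∈ l₂, IsRho ρ) ∧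
    φ = Form.imp (conjList l₁) (disjList l₂)

/-- S4 := {□p→p, □p→□□p}. -/
def S4Ax : Set Form :=
  {Form.imp (Form.box (Form.pv 0)) (Form.pv 0),
   Form.imp (Form.box (Form.pv 0)) (Form.box (Form.box (Form.pv 0)))}

/-- S5 := S4 ∪ {p→□¬□¬p}. -/
def S5Ax : Set Form :=
  S4Ax ∪ {Form.imp (Form.pv 0)
    (Form.box (Form.neg (Form.box (Form.neg (Form.pv 0)))))}

/-- Propositional variables occurring in a formula. -/
def Form.pvs : Form → Finset ℕ
  | .nom _ => ∅
  | .pv p => {p}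
  | .bot => ∅
  | .imp φ ψ => Form.pvs φ ∪ Form.pvs ψ
  | .atf _ φ => Form.pvs φ
  | .fr φ => Form.pvs φ
  | .box φ => Form.pvs φ

theorem Form.sub_of_notMem_noms (m k : ℕ) (φ : Form) (hk : k ∉ φ.noms) : φ.sub m k = φ := by
  induction φ with
  | nom n => simpa [Form.sub] using fun h : n = k => absurd (by simp [Form.noms, h]) hk
  | atf n φ ih =>
    have hk : k ≠ n ∧ k ∉ φ.noms := by simpa [Form.noms] using hk
    simp [Form.sub, ih hk.2, hk.1.symm]
  | _ => simp_all [Form.sub, Form.noms]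

theorem Label.subst_congr {σn τn : ℕ → ℕ} (α : Label) (hα : ∀ n ∈ α.noms, σn n = τn n) :
    α.subst σn = α.subst τn := by
  induction α <;> simp_all [Label.subst, Label.noms]

theorem Label.nats_subst (σn : ℕ → ℕ) (α : Label) : (α.subst σn).nats = α.nats := by
  induction α <;> simp_all [Label.subst, Label.nats]

theorem ApplySub_congr (σp : ℕ → Form) {σn τn : ℕ → ℕ} (φ : Form)
    (hφ : ∀ n ∈ φ.noms, σn n = τn n) : ApplySub σp σn φ = ApplySub σp τn φ := by
  induction φ <;> simp_all [ApplySub, Form.noms]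

/-- Uniform substitution commutes with the replacement of a nominal `k`, once `k` has been sent to
a nominal `k'` that is fresh for the result. -/
theorem ApplySub_sub (σp : ℕ → Form) (σn : ℕ → ℕ) (m k k' : ℕ) (φ : Form)
    (hn : ∀ x ∈ φ.noms, σn x ≠ k') (hp : ∀ p ∈ φ.pvs, k' ∉ (σp p).noms) :
    ApplySub σp σn (φ.sub m k) =
      (ApplySub σp (Function.update σn k k') φ).sub (σn m) k' := by
  induction φ with
  | nom x => by_cases h : x = k <;> simp_all [ApplySub, Form.sub, Form.noms]
  | pv p => simp_all [ApplySub, Form.sub, Form.pvs, Form.sub_of_notMem_noms]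
  | atf x φ ih => by_cases h : x = k <;> simp_all [ApplySub, Form.sub, Form.noms, Form.pvs]
  | _ => simp_all [ApplySub, Form.sub, Form.noms, Form.pvs]

/-- There is a single formula whose instances at `k'` are the substituted instances of `φ` at
`k`. -/
theorem exists_sub_eq_ApplySub_sub (σp : ℕ → Form) (σn : ℕ → ℕ) (k : ℕ) (φ : Form) :
    ∃ (k' : ℕ) (ψ : Form), ∀ m, ApplySub σp σn (φ.sub m k) = ψ.sub (σn m) k' := by
  obtain ⟨k', hfresh⟩ :=
    Infinite.exists_notMem_finset (φ.noms.image σn ∪ φ.pvs.biUnion fun p => (σp p).noms)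
  simp only [Finset.mem_union, Finset.mem_image, Finset.mem_biUnion, not_or, not_exists,
    not_and] at hfresh
  exact ⟨k', _, fun m => ApplySub_sub σp σn m k k' φ hfresh.1 hfresh.2⟩

/-- Uniform substitution on labelled formulas. -/
def LForm.subst (σp : ℕ → Form) (σn : ℕ → ℕ) (l : LForm) : LForm :=
  (Label.subst σn l.1, ApplySub σp σn l.2)

theorem IsTree.image_subst {T : Finset Label} (hT : IsTree T) (σn : ℕ → ℕ) :
    IsTree (T.image (Label.subst σn)) := by
  have root_mem : ∀ j, Label.root j ∈ T.image (Label.subst σn) ↔ Label.root j ∈ T := by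
    intro j
    rw [Finset.mem_image]
    constructor
    · rintro ⟨_ | _, hβ, h⟩
      · cases h
        exact hβ
      · cases h
    · exact fun h => ⟨_, h, rfl⟩
  refine ⟨by simpa only [root_mem] using hT.1, fun α n i h => ?_⟩
  obtain ⟨_ | ⟨β, k, j⟩, hβ, h⟩ := Finset.mem_image.1 h
  · cases h
  · cases h
    exact Finset.mem_image_of_mem _ (hT.2 _ _ _ hβ)

theorem FreshNat.image_subst {i : ℕ} {T : Finset Label} {Γ Δ : Finset LForm}
    (hi : FreshNat i T Γ Δ) (σp : ℕ → Form) (σn : ℕ → ℕ) :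
    FreshNat i (T.image (Label.subst σn)) (Γ.image (LForm.subst σp σn))
      (Δ.image (LForm.subst σp σn)) := by
  simpa only [FreshNat, Finset.forall_mem_image, LForm.subst, Label.nats_subst] using hi

theorem exists_freshNom (T : Finset Label) (Γ Δ : Finset LForm) : ∃ m, FreshNom m T Γ Δ := by
  obtain ⟨m, hm⟩ := Infinite.exists_notMem_finset
    (T.biUnion Label.noms ∪ (Γ ∪ Δ).biUnion fun l => l.1.noms ∪ l.2.noms)
  simp only [Finset.mem_union, Finset.mem_biUnion, not_or, not_exists, not_and] at hm
  exact ⟨m, hm.1, fun l hl => hm.2 l (.inl hl), fun l hl => hm.2 l (.inr hl)⟩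

theorem Label.subst_update {m : ℕ} {α : Label} (hα : m ∉ α.noms) (σn : ℕ → ℕ) (m' : ℕ) :
    α.subst (Function.update σn m m') = α.subst σn :=
  α.subst_congr fun _ hn => Function.update_of_ne (ne_of_mem_of_not_mem hn hα) _ _

theorem LForm.subst_update {m : ℕ} {l : LForm} (hl : m ∉ l.1.noms ∧ m ∉ l.2.noms)
    (σp : ℕ → Form) (σn : ℕ → ℕ) (m' : ℕ) :
    l.subst σp (Function.update σn m m') = l.subst σp σn :=
  Prod.ext (Label.subst_update hl.1 σn m')
    (ApplySub_congr σp l.2 fun _ hn => Function.update_of_ne (ne_of_mem_of_not_mem hn hl.2) _ _)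

/-- Uniform substitution preserves derivations together with their height. -/
theorem Deriv.subst {c : Bool} {T : Finset Label} {Γ Δ : Finset LForm} {h : ℕ}
    (hd : Deriv c T Γ Δ h) (σp : ℕ → Form) (σn : ℕ → ℕ) :
    Deriv c (T.image (Label.subst σn)) (Γ.image (LForm.subst σp σn))
      (Δ.image (LForm.subst σp σn)) h := by
  induction hd generalizing σn with
  | bot α n =>
    rw [Finset.image_insert]
    exact .bot _ _
  | id α n φ =>
    rw [Finset.image_insert, Finset.image_insert]
    exact .id _ _ _
  | rep1 α n m k φ _ ih =>
    obtain ⟨k', ψ, hψ⟩ := exists_sub_eq_ApplySub_sub σp σn k φ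
    have ih := ih σn
    simp only [Finset.image_insert, LForm.subst, hψ] at ih ⊢
    exact .rep1 _ _ _ _ _ ih
  | rep2 α n m k φ _ ih =>
    obtain ⟨k', ψ, hψ⟩ := exists_sub_eq_ApplySub_sub σp σn k φ
    have ih := ih σn
    simp only [Finset.image_insert, LForm.subst, hψ] at ih ⊢
    exact .rep2 _ _ _ _ _ ih
  | refl α n hα _ ih =>
    have ih := ih σn
    rw [Finset.image_insert] at ih
    exact .refl _ _ (Finset.mem_image_of_mem _ hα) ih
  | rigid α β n m hβ _ ih =>
    have ih := ih σn
    rw [Finset.image_insert] at ih ⊢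
    exact .rigid _ _ _ _ (Finset.mem_image_of_mem _ hβ) ih
  | impR α n φ ψ _ ih =>
    have ih := ih σn
    rw [Finset.image_insert, Finset.image_insert] at ih
    rw [Finset.image_insert]
    exact .impR _ _ _ _ ih
  | impL α n φ ψ _ _ ih₁ ih₂ =>
    have ih₁ := ih₁ σn
    have ih₂ := ih₂ σn
    rw [Finset.image_insert] at ih₁ ih₂ ⊢
    exact .impL _ _ _ _ ih₁ ih₂
  | atR α n m φ _ ih =>
    have ih := ih σn
    rw [Finset.image_insert] at ih ⊢
    exact .atR _ _ _ _ ih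
  | atL α n m φ _ ih =>
    have ih := ih σn
    rw [Finset.image_insert] at ih ⊢
    exact .atL _ _ _ _ ih
  | @frR T Γ Δ h α n m φ hm _ ih =>
    obtain ⟨m', hm'⟩ := exists_freshNom (T.image (Label.subst σn)) (Γ.image (LForm.subst σp σn))
      ((insert (α, Form.atf n (Form.fr φ)) Δ).image (LForm.subst σp σn))
    obtain ⟨hT, hΓ, hΔ⟩ := hm
    rw [Finset.forall_mem_insert] at hΔ
    obtain ⟨⟨hα, hnφ⟩, hΔ⟩ := hΔ
    have hnφ : m ≠ n ∧ m ∉ φ.noms := by simpa [Form.noms] using hnφ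
    have ih := ih (Function.update σn m m')
    have eT : T.image (Label.subst (Function.update σn m m')) = T.image (Label.subst σn) :=
      Finset.image_congr fun β hβ => Label.subst_update (hT β hβ) σn m'
    have eΓ : Γ.image (LForm.subst σp (Function.update σn m m')) = Γ.image (LForm.subst σp σn) :=
      Finset.image_congr fun l hl => LForm.subst_update (hΓ l hl) σp σn m'
    have eΔ : Δ.image (LForm.subst σp (Function.update σn m m')) = Δ.image (LForm.subst σp σn) :=
      Finset.image_congr fun l hl => LForm.subst_update (hΔ l hl) σp σn m'
    have eφ : ApplySub σp (Function.update σn m m') φ = ApplySub σp σn φ :=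
      congrArg Prod.snd (LForm.subst_update (l := (α, φ)) ⟨hα, hnφ.2⟩ σp σn m')
    simp only [Finset.image_insert, LForm.subst, ApplySub, Form.diaF, Form.neg,
      Label.subst_update hα, eφ, Function.update_self, Function.update_of_ne hnφ.1.symm] at ih
    rw [eT, eΓ, eΔ] at ih
    rw [Finset.image_insert] at hm' ⊢
    exact .frR _ _ _ _ hm' ih
  | frL α n m φ _ _ ih₁ ih₂ =>
    have ih₁ := ih₁ σn
    have ih₂ := ih₂ σn
    rw [Finset.image_insert] at ih₁ ih₂ ⊢
    exact .frL _ _ _ _ ih₁ ih₂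
  | boxR α n i φ hi _ ih =>
    have hi := hi.image_subst σp σn
    have ih := ih σn
    rw [Finset.image_insert, Finset.image_insert] at ih
    rw [Finset.image_insert] at hi ⊢
    exact .boxR _ _ _ _ hi ih
  | boxL α n i φ hα _ ih =>
    have ih := ih σn
    rw [Finset.image_insert] at ih ⊢
    exact .boxL _ _ _ _ (Finset.mem_image_of_mem (Label.subst σn) hα) ih
  | wlab α hT _ ih =>
    have hT := hT.image_subst σn
    rw [Finset.image_insert] at hT ⊢
    exact .wlab _ hT (ih σn)
  | cut α n φ hc hα _ _ ih₁ ih₂ =>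
    have ih₁ := ih₁ σn
    have ih₂ := ih₂ σn
    rw [Finset.image_insert] at ih₁ ih₂
    rw [Finset.image_union, Finset.image_union]
    exact .cut _ _ _ hc (Finset.mem_image_of_mem _ hα) ih₁ ih₂

/-- height-preserving admissibility of uniform substitution
    in TEFL⁻ (c = false) and TEFL (c = true). -/
theorem substitution_hp_admissible (c : Bool) (σp : ℕ → Form) (σn : ℕ → ℕ)
    (T : Finset Label) (Γ Δ : Finset LForm) (h : ℕ)
    (hd : Deriv c T Γ Δ h) :
    ∃ h' ≤ h, Deriv c (T.image (Label.subst σn))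
      (Γ.image (fun l => (Label.subst σn l.1, ApplySub σp σn l.2)))
      (Δ.image (fun l => (Label.subst σn l.1, ApplySub σp σn l.2))) h' := by
  exact ⟨h, le_rfl, hd.subst σp σn⟩
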